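/- arXiv:0811.2936 — 2 statements merged into one kernel-verified Lean document; each statement's English description precedes it below -/
import Mathlib

section
/- For n = 1, 2, 3, 4, 5, 6, 7, 8, the number of (−1)-classes of the dP_n lattice, i.e. the cardinality of the finite set {v ∈ ℤ^{n+1} : v·v = −1 and v·K = −1}, is respectively 1, 3, 6, 10, 16, 27, 56, and 240. -/
namespace Stmt2

/-- Intersection form of the dP_m lattice `ℤ^{m+1}` with basis `l, e₁, …, e_m`. -/
def dot {m : ℕ} (x y : Fin (m + 1) → ℤ) : ℤ :=
  x 0 * y 0 - ∑ i : Fin m, x i.succ * y i.succ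

/-- The canonical class `K = -3l + e₁ + ⋯ + e_m`. -/
def K {m : ℕ} : Fin (m + 1) → ℤ := fun i => if i = 0 then -3 else 1

/-- The (−1)-classes of the dP_m lattice: vectors `v` with `v·v = -1` and `v·K = -1`. -/
def negOneClasses (m : ℕ) : Set (Fin (m + 1) → ℤ) := {v | dot v v = -1 ∧ dot v K = -1}

/-- Counting a finite set of integer vectors by the value of the first coordinate. -/
theorem fiber_count {n : ℕ} (P : (Fin (n + 1) → ℤ) → Prop) (L : List ℤ) (hL : L.Nodup)
    (c : ℤ → ℕ) (h : ∀ f, P f → f 0 ∈ L)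
    (hc : ∀ b ∈ L, ∃ T : Finset (Fin n → ℤ), (∀ g, g ∈ T ↔ P (Fin.cons b g)) ∧ T.card = c b) :
    ∃ T : Finset (Fin (n + 1) → ℤ), (∀ f, f ∈ T ↔ P f) ∧ T.card = (L.map c).sum := by
  classical
  have hc' : ∀ b, ∃ T : Finset (Fin n → ℤ),
      b ∈ L → (∀ g, g ∈ T ↔ P (Fin.cons b g)) ∧ T.card = c b := by
    intro b
    by_cases hb : b ∈ L
    · obtain ⟨T, hT⟩ := hc b hb
      exact ⟨T, fun _ => hT⟩
    · exact ⟨∅, fun hb' => absurd hb' hb⟩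
  choose T hT using hc'
  refine ⟨L.toFinset.biUnion fun b => (T b).image (Fin.cons (α := fun _ => ℤ) b),
    ?_, ?_⟩
  · intro f
    simp only [Finset.mem_biUnion, List.mem_toFinset, Finset.mem_image]
    constructor
    · rintro ⟨b, hb, g, hg, rfl⟩
      exact ((hT b hb).1 g).1 hg
    · intro hf
      refine ⟨f 0, h f hf, Fin.tail f, ?_, Fin.cons_self_tail f⟩
      rw [(hT _ (h f hf)).1, Fin.cons_self_tail]
      exact hf
  · rw [Finset.card_biUnion, ← List.sum_toFinset _ hL]
    · apply Finset.sum_congr rfl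
      intro b hb
      rw [Finset.card_image_of_injective _ (Fin.cons_right_injective (α := fun _ => ℤ) b)]
      exact (hT b (List.mem_toFinset.1 hb)).2
    · intro a _ b _ hab
      rw [Function.onFun, Finset.disjoint_left]
      intro f hfa hfb
      obtain ⟨g, _, rfl⟩ := Finset.mem_image.1 hfa
      obtain ⟨g', _, hg'⟩ := Finset.mem_image.1 hfb
      have := congrFun hg' 0
      simp only [Fin.cons_zero] at this
      exact hab this.symm

/-- Candidate coordinate values. -/
def vals : List ℤ := [-8, -7, -6, -5, -4, -3, -2, -1, 0, 1, 2, 3, 4, 5, 6, 7, 8]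

/-- Number of integer vectors of length `n` with sum `s` and square sum `q` (for `q ≤ 64`),
computed recursively with pruning by the Cauchy-Schwarz inequality. -/
def cnt : ℕ → ℤ → ℤ → ℕ
  | 0, s, q => if s = 0 ∧ q = 0 then 1 else 0
  | n + 1, s, q => (vals.map fun b =>
      if (s - b) * (s - b) ≤ (n : ℤ) * (q - b * b) then cnt n (s - b) (q - b * b) else 0).sum

theorem cnt_spec (n : ℕ) : ∀ s q : ℤ, q ≤ 64 → ∃ T : Finset (Fin n → ℤ),
    (∀ g, g ∈ T ↔ (∑ i, g i = s ∧ ∑ i, g i * g i = q)) ∧ T.card = cnt n s q := by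
  classical
  induction n with
  | zero =>
    intro s q _
    by_cases h : s = 0 ∧ q = 0
    · refine ⟨Finset.univ, ?_, ?_⟩
      · intro g
        simp [h.1, h.2, eq_iff_true_of_subsingleton]
      · simp [cnt, h]
    · refine ⟨∅, ?_, ?_⟩
      · intro g
        simp only [Finset.notMem_empty, Finset.univ_eq_empty, Finset.sum_empty, false_iff]
        exact fun h' => h ⟨h'.1.symm, h'.2.symm⟩
      · simp [cnt, h]
  | succ n ih =>
    intro s q hq
    refine fiber_count (fun g => ∑ i, g i = s ∧ ∑ i, g i * g i = q) vals (by decide) _ ?_ ?_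
    · rintro f ⟨_, hf⟩
      have h1 : f 0 * f 0 ≤ ∑ i, f i * f i :=
        Finset.single_le_sum (f := fun i => f i * f i) (fun i _ => mul_self_nonneg (f i))
          (Finset.mem_univ 0)
      have h2 : f 0 ≤ 8 := by nlinarith
      have h3 : -8 ≤ f 0 := by nlinarith
      generalize f 0 = x at h2 h3
      simp only [vals, List.mem_cons, List.not_mem_nil, or_false]
      omega
    · intro b _
      simp only [Fin.sum_univ_succ, Fin.cons_zero, Fin.cons_succ]
      split_ifs with hb
      · obtain ⟨T, hT, hc⟩ := ih (s - b) (q - b * b) (by nlinarith [mul_self_nonneg b])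
        refine ⟨T, fun g => ?_, hc⟩
        rw [hT]
        constructor <;> rintro ⟨h1, h2⟩ <;> constructor <;> linarith
      · refine ⟨∅, fun g => ?_, rfl⟩
        simp only [Finset.notMem_empty, false_iff]
        rintro ⟨h1, h2⟩
        apply hb
        have := sq_sum_le_card_mul_sum_sq (s := Finset.univ) (f := g)
        have e1 : s - b = ∑ i, g i := by linarith
        have e2 : q - b * b = ∑ i, g i * g i := by linarith
        rw [e1, e2]
        simpa [sq] using this

/-- Candidate degrees. -/
def degs : List ℤ := [-1, 0, 1, 2, 3, 4, 5, 6, 7]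

theorem class_count (n : ℕ) (hn : n ≤ 8) :
    (negOneClasses n).Finite ∧ (negOneClasses n).ncard =
      (degs.map fun a => cnt n (1 - 3 * a) (a * a + 1)).sum := by
  have key : ∀ (a : ℤ) (g : Fin n → ℤ), (Fin.cons a g : Fin (n + 1) → ℤ) ∈ negOneClasses n ↔
      (∑ i, g i = 1 - 3 * a ∧ ∑ i, g i * g i = a * a + 1) := by
    intro a g
    simp only [negOneClasses, Set.mem_ofPred_eq, dot, K, Fin.cons_zero, Fin.cons_succ,
      Fin.succ_ne_zero, if_true, if_false, mul_one]
    constructor <;> rintro ⟨h1, h2⟩ <;> constructor <;> linarith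
  obtain ⟨T, hT, hc⟩ := fiber_count (fun v => v ∈ negOneClasses n) degs (by decide)
    (fun a => cnt n (1 - 3 * a) (a * a + 1)) (by
      intro f hf
      rw [← Fin.cons_self_tail f, key] at hf
      obtain ⟨h1, h2⟩ := hf
      have := sq_sum_le_card_mul_sum_sq (s := Finset.univ) (f := Fin.tail f)
      simp only [sq, h1, h2, Finset.card_univ, Fintype.card_fin] at this
      have hn' : (n : ℤ) ≤ 8 := by exact_mod_cast hn
      generalize f 0 = x at this
      have h3 : (1 - 3 * x) * (1 - 3 * x) ≤ 8 * (x * x + 1) :=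
        this.trans (mul_le_mul_of_nonneg_right hn' (by nlinarith [mul_self_nonneg x]))
      have h4 : x ≤ 7 := by nlinarith
      have h5 : -1 ≤ x := by nlinarith
      simp only [degs, List.mem_cons, List.not_mem_nil, or_false]
      omega) (by
      intro a ha
      obtain ⟨T, hT, hc⟩ := cnt_spec n (1 - 3 * a) (a * a + 1) (by
        simp only [degs, List.mem_cons, List.not_mem_nil, or_false] at ha
        rcases ha with h | h | h | h | h | h | h | h | h <;> subst h <;> norm_num)
      exact ⟨T, fun g => (hT g).trans (key a g).symm, hc⟩)
  have e : negOneClasses n = (T : Set (Fin (n + 1) → ℤ)) := by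
    ext v
    exact (hT v).symm
  rw [e]
  exact ⟨T.finite_toSet, by rw [Set.ncard_coe_finset, hc]⟩

theorem class_count_eq (n : ℕ) (k : ℕ) (hn : n ≤ 8)
    (h : (degs.map fun a => cnt n (1 - 3 * a) (a * a + 1)).sum = k) :
    (negOneClasses n).Finite ∧ (negOneClasses n).ncard = k :=
  ⟨(class_count n hn).1, (class_count n hn).2.trans h⟩

/-- For `n = 1, 2, 3, 4, 5, 6, 7, 8`, the number of (−1)-classes of the dP_n lattice is
respectively `1, 3, 6, 10, 16, 27, 56, 240`. -/
theorem statement2 :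
    ((negOneClasses 1).Finite ∧ (negOneClasses 1).ncard = 1) ∧
    ((negOneClasses 2).Finite ∧ (negOneClasses 2).ncard = 3) ∧
    ((negOneClasses 3).Finite ∧ (negOneClasses 3).ncard = 6) ∧
    ((negOneClasses 4).Finite ∧ (negOneClasses 4).ncard = 10) ∧
    ((negOneClasses 5).Finite ∧ (negOneClasses 5).ncard = 16) ∧
    ((negOneClasses 6).Finite ∧ (negOneClasses 6).ncard = 27) ∧
    ((negOneClasses 7).Finite ∧ (negOneClasses 7).ncard = 56) ∧
    ((negOneClasses 8).Finite ∧ (negOneClasses 8).ncard = 240) := by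
  refine ⟨?_, ?_, ?_, ?_, ?_, ?_, ?_, ?_⟩
  · exact class_count_eq 1 1 (by norm_num) (by decide +kernel)
  · exact class_count_eq 2 3 (by norm_num) (by decide +kernel)
  · exact class_count_eq 3 6 (by norm_num) (by decide +kernel)
  · exact class_count_eq 4 10 (by norm_num) (by decide +kernel)
  · exact class_count_eq 5 16 (by norm_num) (by decide +kernel)
  · exact class_count_eq 6 27 (by norm_num) (by decide +kernel)
  · exact class_count_eq 7 56 (by norm_num) (by decide +kernel)
  · exact class_count_eq 8 240 (by norm_num) (by decide +kernel)

end Stmt2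
end

section
/- The group of all ℤ-linear automorphisms of the dP_8 lattice ℤ^9 that preserve the intersection form and fix the canonical class K is a finite group of order 696729600 (the order of the Weyl group of E_8). -/
namespace Stmt13

/-- Intersection form of the dP₈ lattice `ℤ⁹` with basis `l, e₁, …, e₈`. -/
def dot (x y : Fin 9 → ℤ) : ℤ := x 0 * y 0 - ∑ i : Fin 8, x i.succ * y i.succ

/-- The canonical class `K = -3l + e₁ + ⋯ + e₈`. -/
def K : Fin 9 → ℤ := fun i => if i = 0 then -3 else 1

theorem inv_coe (a : (Fin 9 → ℤ) ≃ₗ[ℤ] (Fin 9 → ℤ)) : ⇑(a⁻¹) = ⇑(a.symm) := rfl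

/-- The group of all ℤ-linear automorphisms of the dP₈ lattice that preserve the
intersection form and fix the canonical class `K`. -/
def AutK : Subgroup ((Fin 9 → ℤ) ≃ₗ[ℤ] (Fin 9 → ℤ)) where
  carrier := {g | (∀ x y, dot (g x) (g y) = dot x y) ∧ g K = K}
  one_mem' := ⟨fun _ _ => rfl, rfl⟩
  mul_mem' := by
    rintro a b ⟨ha1, ha2⟩ ⟨hb1, hb2⟩
    constructor
    · intro x y
      show dot (a (b x)) (a (b y)) = dot x y
      rw [ha1, hb1]
    · show a (b K) = K
      rw [hb2, ha2]
  inv_mem' := by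
    rintro a ⟨h1, h2⟩
    constructor
    · intro x y
      have := h1 (a⁻¹ x) (a⁻¹ y)
      rw [inv_coe, a.apply_symm_apply, a.apply_symm_apply] at this
      rw [inv_coe]
      exact this.symm
    · rw [inv_coe]
      conv_lhs => rw [← h2]
      exact a.symm_apply_apply K


/-! ### Bilinearity of the form and reflections -/

theorem dot_comm (x y : Fin 9 → ℤ) : dot x y = dot y x := by
  simp only [dot, mul_comm]

theorem dot_add_left (x y z : Fin 9 → ℤ) : dot (x + y) z = dot x z + dot y z := by
  simp only [dot, Pi.add_apply, add_mul, Finset.sum_add_distrib]; ring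

theorem dot_smul_left (c : ℤ) (x z : Fin 9 → ℤ) : dot (c • x) z = c * dot x z := by
  simp only [dot, Pi.smul_apply, smul_eq_mul, mul_sub, Finset.mul_sum, mul_assoc]

theorem dot_add_right (x y z : Fin 9 → ℤ) : dot z (x + y) = dot z x + dot z y := by
  rw [dot_comm, dot_add_left, dot_comm x, dot_comm y]

theorem dot_smul_right (c : ℤ) (x z : Fin 9 → ℤ) : dot z (c • x) = c * dot z x := by
  rw [dot_comm, dot_smul_left, dot_comm x]

theorem dot_sub_left (x y z : Fin 9 → ℤ) : dot (x - y) z = dot x z - dot y z := by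
  have := dot_add_left (x - y) y z
  rw [sub_add_cancel] at this
  linarith

theorem dot_sub_right (x y z : Fin 9 → ℤ) : dot z (x - y) = dot z x - dot z y := by
  rw [dot_comm, dot_sub_left, dot_comm x, dot_comm y]

/-- Reflection in a vector of square `-2`, as a linear map. -/
def reflMap (r : Fin 9 → ℤ) : (Fin 9 → ℤ) →ₗ[ℤ] (Fin 9 → ℤ) where
  toFun x := x + dot x r • r
  map_add' x y := by rw [dot_add_left, add_smul]; abel
  map_smul' c x := by rw [dot_smul_left, mul_smul, smul_add]; rfl

theorem reflMap_apply (r x : Fin 9 → ℤ) : reflMap r x = x + dot x r • r := rfl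

theorem reflMap_invol (r : Fin 9 → ℤ) (hr : dot r r = -2) :
    Function.Involutive (reflMap r) := by
  intro x
  simp only [reflMap_apply, dot_add_left, dot_smul_left, hr]
  rw [add_assoc, ← add_smul]
  have : dot x r + (dot x r + dot x r * -2) = 0 := by ring
  rw [this, zero_smul, add_zero]

/-- Reflection in a vector of square `-2`. -/
def refl (r : Fin 9 → ℤ) (hr : dot r r = -2) : (Fin 9 → ℤ) ≃ₗ[ℤ] (Fin 9 → ℤ) :=
  LinearEquiv.ofInvolutive (reflMap r) (reflMap_invol r hr)

theorem refl_apply (r : Fin 9 → ℤ) (hr : dot r r = -2) (x : Fin 9 → ℤ) :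
    refl r hr x = x + dot x r • r := rfl

theorem refl_mem (r : Fin 9 → ℤ) (hr : dot r r = -2) (hK : dot K r = 0) :
    refl r hr ∈ AutK := by
  refine ⟨fun x y => ?_, ?_⟩
  · simp only [refl_apply, dot_add_left, dot_add_right, dot_smul_left, dot_smul_right, hr,
      dot_comm r y]
    ring
  · rw [refl_apply, hK, zero_smul, add_zero]

/-! ### The chain of pointwise stabilizers -/

/-- The standard basis. -/
def E (i : Fin 9) : Fin 9 → ℤ := Pi.single i 1

/-- The subgroup of `AutK` fixing `e_i` for all `i > m`. -/
def G (m : ℕ) : Subgroup ((Fin 9 → ℤ) ≃ₗ[ℤ] (Fin 9 → ℤ)) where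
  carrier := {g | g ∈ AutK ∧ ∀ i : Fin 9, m < (i : ℕ) → g (E i) = E i}
  one_mem' := ⟨AutK.one_mem, fun _ _ => rfl⟩
  mul_mem' := by
    rintro a b ⟨ha1, ha2⟩ ⟨hb1, hb2⟩
    refine ⟨AutK.mul_mem ha1 hb1, fun i hi => ?_⟩
    show a (b (E i)) = E i
    rw [hb2 i hi, ha2 i hi]
  inv_mem' := by
    rintro a ⟨h1, h2⟩
    refine ⟨AutK.inv_mem h1, fun i hi => ?_⟩
    rw [inv_coe]
    conv_lhs => rw [← h2 i hi]
    exact a.symm_apply_apply _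

theorem mem_G {m : ℕ} {g : (Fin 9 → ℤ) ≃ₗ[ℤ] (Fin 9 → ℤ)} :
    g ∈ G m ↔ g ∈ AutK ∧ ∀ i : Fin 9, m < (i : ℕ) → g (E i) = E i := Iff.rfl

theorem G_eight : G 8 = AutK := by
  ext g
  rw [mem_G]
  exact ⟨fun h => h.1, fun h => ⟨h, fun i hi => by omega⟩⟩

theorem K_eq : K = (-3 : ℤ) • E 0 + ∑ i : Fin 8, E i.succ := by
  ext j
  fin_cases j <;> simp [K, E, Fin.sum_univ_succ, Fin.ext_iff]

theorem G_zero : G 0 = ⊥ := by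
  rw [eq_bot_iff]
  rintro g ⟨⟨-, h1⟩, h2⟩
  have hs : ∀ i : Fin 8, g (E i.succ) = E i.succ := fun i => h2 _ (by simp)
  have h0 : g (E 0) = E 0 := by
    have := h1
    rw [K_eq, map_add, map_smul, map_sum] at this
    simp only [hs] at this
    have h3 := add_right_cancel this
    ext j
    have := congrFun h3 j
    simp only [Pi.smul_apply, smul_eq_mul] at this
    linarith
  rw [Subgroup.mem_bot]
  apply LinearEquiv.toLinearMap_injective
  apply LinearMap.pi_ext'
  intro i
  ext1
  show g (E i) = E i
  refine Fin.cases h0 hs i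

theorem card_step (m : ℕ) (hm : m + 1 < 9) :
    Nat.card (G (m + 1)) =
      (MulAction.orbit (G (m + 1)) (E ⟨m + 1, hm⟩)).ncard * Nat.card (G m) := by
  rw [← MulAction.index_stabilizer, mul_comm,
    ← Subgroup.card_mul_index (MulAction.stabilizer (G (m + 1)) (E ⟨m + 1, hm⟩))]
  congr 1
  refine Nat.card_congr
    { toFun := fun g => ⟨g.1.1, ?_⟩
      invFun := fun g => ⟨⟨g.1, ?_⟩, ?_⟩
      left_inv := fun _ => rfl
      right_inv := fun _ => rfl }
  · obtain ⟨⟨g, hg⟩, hs⟩ := g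
    refine ⟨hg.1, fun i hi => ?_⟩
    by_cases h : (i : ℕ) = m + 1
    · have : i = ⟨m + 1, hm⟩ := Fin.ext h
      rw [this]
      exact hs
    · exact hg.2 i (by omega)
  · exact ⟨g.2.1, fun i hi => g.2.2 i (by omega)⟩
  · exact g.2.2 ⟨m + 1, hm⟩ (by simp)

/-! ### Exceptional vectors -/

/-- Exceptional vectors orthogonal to `e_i` for `i > m`. -/
def Exc (m : ℕ) (v : Fin 9 → ℤ) : Prop :=
  dot v v = -1 ∧ dot K v = -1 ∧ ∀ i : Fin 9, m < (i : ℕ) → dot (E i) v = 0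

theorem refl_orbit {m : ℕ} {x v w : Fin 9 → ℤ} (hv : Exc m v) (hw : Exc m w)
    (h : dot v w = 0) (ho : v ∈ MulAction.orbit (G m) x) : w ∈ MulAction.orbit (G m) x := by
  have hr : dot (v - w) (v - w) = -2 := by
    simp only [dot_sub_left, dot_sub_right, hv.1, hw.1, h, dot_comm w v]; norm_num
  have hg : refl (v - w) hr ∈ G m := by
    refine ⟨refl_mem _ _ ?_, fun i hi => ?_⟩
    · rw [dot_sub_right, hv.2.1, hw.2.1]; norm_num
    · rw [refl_apply, dot_sub_right, hv.2.2 i hi, hw.2.2 i hi]; simp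
  have hgv : (⟨_, hg⟩ : G m) • v = w := by
    show refl (v - w) hr v = w
    rw [refl_apply, dot_sub_right, hv.1, h]
    ext j
    simp
  rw [← hgv]
  obtain ⟨g, rfl⟩ := ho
  exact ⟨⟨_, hg⟩ * g, mul_smul _ _ _⟩

theorem E_dot (i : Fin 8) (v : Fin 9 → ℤ) : dot (E i.succ) v = - v i.succ := by
  simp [dot, E, Pi.single_apply]

theorem E_exc (m : ℕ) (hm : m + 1 < 9) : Exc (m + 1) (E ⟨m + 1, hm⟩) := by
  have h1 : (⟨m + 1, hm⟩ : Fin 9) = Fin.succ ⟨m, by omega⟩ := rfl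
  rw [h1]
  refine ⟨?_, ?_, ?_⟩
  · rw [E_dot]; simp [E]
  · rw [dot_comm, E_dot]; simp [K]
  · intro i hi
    rw [dot_comm, E_dot]
    have : (Fin.succ ⟨m, by omega⟩ : Fin 9) ≠ i := by
      intro h; rw [← h] at hi; simp at hi
    rw [E, Pi.single_apply, if_neg this, neg_zero]

theorem orbit_exc {m : ℕ} {x v : Fin 9 → ℤ} (hx : Exc m x)
    (ho : v ∈ MulAction.orbit (G m) x) : Exc m v := by
  obtain ⟨⟨g, hg⟩, rfl⟩ := ho
  show Exc m (g x)
  refine ⟨?_, ?_, fun i hi => ?_⟩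
  · rw [hg.1.1, hx.1]
  · rw [← hx.2.1, ← hg.1.1 K x, hg.1.2]
  · rw [← hx.2.2 i hi, ← hg.1.1 (E i) x, hg.2 i hi]

/-! ### Enumeration -/

/-- Candidate values of a coordinate. -/
def rng : List ℤ := [0, 1, -1, -2, -3]

theorem mem_rng (a : ℤ) (h1 : -3 ≤ a) (h2 : a ≤ 1) : a ∈ rng := by
  interval_cases a <;> decide

/-- Candidate values of the degree. -/
def rngD : List ℤ := [-1, 0, 1, 2, 3, 4, 5, 6, 7]

theorem mem_rngD (a : ℤ) (h1 : -1 ≤ a) (h2 : a ≤ 7) : a ∈ rngD := by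
  interval_cases a <;> decide

/-- Integer lists of length `n` with given sum and sum of squares. -/
def sols : ℕ → ℤ → ℤ → List (List ℤ)
  | 0, s, q => if s = 0 ∧ q = 0 then [[]] else []
  | n + 1, s, q =>
    if s * s ≤ (n + 1 : ℕ) * q then
      rng.flatMap (fun a => (sols n (s - a) (q - a * a)).map (fun l => a :: l))
    else []

theorem sq_nonneg_list (l : List ℤ) : 0 ≤ (l.map (fun a => a * a)).sum := by
  induction l with
  | nil => simp
  | cons a l ih => simp only [List.map_cons, List.sum_cons]; nlinarith [mul_self_nonneg a]

theorem cs_list (l : List ℤ) :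
    l.sum * l.sum ≤ (l.length : ℤ) * (l.map (fun a => a * a)).sum := by
  induction l with
  | nil => simp
  | cons a l ih =>
    simp only [List.map_cons, List.sum_cons, List.length_cons]
    push_cast
    have hq := sq_nonneg_list l
    generalize (l.map (fun a => a * a)).sum = q at *
    generalize l.sum = s at *
    rcases Nat.eq_zero_or_pos l.length with h | h
    · rw [h] at ih ⊢
      have : s = 0 := by
        apply mul_self_eq_zero.mp
        have := mul_self_nonneg s
        simp at ih
        simpa using le_antisymm ih this
      subst this
      simp
      exact hq
    · have hn : (0 : ℤ) < l.length := by exact_mod_cast h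
      generalize (l.length : ℤ) = n at *
      have h2 : 0 ≤ n * (n * (a * a) + q - 2 * a * s) := by
        nlinarith [mul_self_nonneg (n * a - s)]
      have h3 := nonneg_of_mul_nonneg_right h2 hn
      nlinarith

theorem mem_sols (l : List ℤ) (hq : ∀ a ∈ l, a ∈ rng) :
    l ∈ sols l.length l.sum (l.map (fun a => a * a)).sum := by
  induction l with
  | nil => simp [sols]
  | cons a l ih =>
    have hcs := cs_list (a :: l)
    simp only [List.map_cons, List.sum_cons, List.length_cons] at hcs ⊢
    rw [sols, if_pos hcs, List.mem_flatMap]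
    refine ⟨a, hq a List.mem_cons_self, ?_⟩
    rw [List.mem_map]
    refine ⟨l, ?_, rfl⟩
    rw [add_sub_cancel_left, add_sub_cancel_left]
    exact ih (fun b hb => hq b (List.mem_cons_of_mem _ hb))

theorem nodup_consMap (r : List ℤ) (hr : r.Nodup) (f : ℤ → List (List ℤ))
    (hf : ∀ a, (f a).Nodup) : (r.flatMap (fun a => (f a).map (fun l => a :: l))).Nodup := by
  rw [List.nodup_flatMap]
  refine ⟨fun a _ => (hf a).map (fun x y h => (List.cons.inj h).2), ?_⟩
  refine hr.imp ?_
  intro a b hab l h1 h2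
  obtain ⟨x, -, rfl⟩ := List.mem_map.mp h1
  obtain ⟨y, -, h⟩ := List.mem_map.mp h2
  exact hab (List.cons.inj h).1.symm

theorem sols_nodup (n : ℕ) : ∀ s q : ℤ, (sols n s q).Nodup := by
  induction n with
  | zero => intro s q; rw [sols]; split_ifs <;> simp
  | succ n ih =>
    intro s q
    rw [sols]
    split_ifs
    · exact nodup_consMap rng (by decide) _ (fun a => ih _ _)
    · simp

/-- All exceptional vectors, as lists. -/
def allExc : List (List ℤ) :=
  rngD.flatMap (fun d => (sols 8 (1 - 3 * d) (d * d + 1)).map (fun l => d :: l))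

/-- List version of the orbit of `e_m` under `G m`. -/
def L (m : ℕ) : List (List ℤ) :=
  allExc.filter (fun l => (l.drop (m + 1)).all (fun a => a == 0) && (m != 2 || l.headD 0 == 0))

/-- Euclidean product of lists. -/
def sdot : List ℤ → List ℤ → ℤ
  | a :: u, b :: v => a * b + sdot u v
  | _, _ => 0

/-- List version of `dot`. -/
def ldot : List ℤ → List ℤ → ℤ
  | a :: u, b :: v => a * b - sdot u v
  | _, _ => 0

theorem ldot_ofFn (u v : Fin 9 → ℤ) : ldot (List.ofFn u) (List.ofFn v) = dot u v := by
  simp [List.ofFn_succ, ldot, sdot, dot, Fin.sum_univ_succ]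

theorem dropZ {v : Fin 9 → ℤ} {m : ℕ} :
    ((List.ofFn v).drop (m + 1)).all (fun a => a == 0) = true ↔
      ∀ i : Fin 9, m < (i : ℕ) → dot (E i) v = 0 := by
  rw [List.all_eq_true]
  constructor
  · intro h i hi
    obtain ⟨j, rfl⟩ := Fin.exists_succ_eq.mpr (show i ≠ 0 by rintro rfl; simp at hi)
    rw [E_dot]
    have := h (v j.succ) (by
      rw [List.mem_drop_iff_getElem]
      have hj : (j.succ : ℕ) < 9 := j.succ.2
      refine ⟨(j.succ : ℕ) - (m + 1), by simp only [List.length_ofFn]; omega, ?_⟩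
      rw [List.getElem_ofFn]
      congr 1
      ext
      simp only
      omega)
    simpa using this
  · intro h a ha
    rw [List.mem_drop_iff_getElem] at ha
    obtain ⟨j, hj, rfl⟩ := ha
    rw [List.length_ofFn] at hj
    rw [List.getElem_ofFn]
    have h2 := h (Fin.succ ⟨m + j, by omega⟩) (by simp only [Fin.val_succ]; omega)
    rw [E_dot] at h2
    have h3 : (⟨m + 1 + j, by omega⟩ : Fin 9) = Fin.succ ⟨m + j, by omega⟩ := by
      ext; simp; omega
    rw [h3]
    simpa using h2

theorem exc_mem {v : Fin 9 → ℤ} {m : ℕ} (hv : Exc m v) : List.ofFn v ∈ allExc := by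
  obtain ⟨h1, h2, -⟩ := hv
  have hlen : (List.ofFn fun i : Fin 8 => v i.succ).length = 8 := by simp
  have hsum : (List.ofFn fun i : Fin 8 => v i.succ).sum = 1 - 3 * v 0 := by
    rw [List.sum_ofFn]
    simp [dot, K] at h2
    linarith
  have hsq : ((List.ofFn fun i : Fin 8 => v i.succ).map (fun a => a * a)).sum
      = v 0 * v 0 + 1 := by
    rw [List.map_ofFn, List.sum_ofFn]
    simp only [dot] at h1
    simp only [Function.comp_def]
    linarith
  have hcs := cs_list (List.ofFn fun i : Fin 8 => v i.succ)
  rw [hlen, hsum, hsq] at hcs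
  push_cast at hcs
  have hd1 : -1 ≤ v 0 := by nlinarith
  have hd2 : v 0 ≤ 7 := by nlinarith
  have := mem_sols (List.ofFn fun i : Fin 8 => v i.succ) (by
    intro a ha
    obtain ⟨i, rfl⟩ := (List.mem_ofFn' _ _).mp ha
    show v i.succ ∈ rng
    have hc := sq_sum_le_card_mul_sum_sq (s := Finset.univ.erase i) (f := fun i => v i.succ)
    rw [List.sum_ofFn] at hsum
    rw [List.map_ofFn, List.sum_ofFn] at hsq
    rw [← Finset.add_sum_erase _ _ (Finset.mem_univ i)] at hsum hsq
    simp only [Function.comp_def, ← pow_two] at hsq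
    have hcard : (Finset.univ.erase i).card = 7 := by simp
    rw [hcard, eq_sub_of_add_eq' hsum, eq_sub_of_add_eq' hsq] at hc
    push_cast at hc
    generalize v i.succ = a at *
    generalize v 0 = d at *
    have h7 : (a + 3) * (a - 1) ≤ 0 := by nlinarith [sq_nonneg (2 * d + 3 * a - 3)]
    exact mem_rng a (by nlinarith) (by nlinarith))
  rw [hlen, hsum, hsq] at this
  rw [allExc, List.mem_flatMap]
  refine ⟨v 0, mem_rngD _ hd1 hd2, ?_⟩
  rw [List.mem_map]
  exact ⟨_, this, (List.ofFn_succ (f := v)).symm⟩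


/-- Adjacency: equal or orthogonal. -/
def adj (u v : List ℤ) : Bool := ldot u v == 0 || u == v

/-- One breadth-first step. -/
def step (m : ℕ) (S : List (List ℤ)) : List (List ℤ) :=
  (L m).filter (fun v => S.any (fun u => adj u v))

/-- `K` as a list. -/
def Kl : List ℤ := [-3, 1, 1, 1, 1, 1, 1, 1, 1]

/-- Everything in `L m` is reached from `e` in three steps. -/
def chkReach (m : ℕ) (e : List ℤ) : Bool :=
  (L m).all (fun v => (step m (step m [e])).any (fun u => adj u v))

theorem allExc_ok : ∀ l ∈ allExc, l.length = 9 ∧ ldot l l = -1 ∧ ldot Kl l = -1 := by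
  decide +kernel

theorem allExc_nodup : allExc.Nodup :=
  nodup_consMap rngD (by decide) _ (fun _ => sols_nodup _ _ _)

theorem L2_ok : ∀ u ∈ allExc.filter (fun l => (l.drop 3).all (fun a => a == 0)),
    ∀ w ∈ allExc.filter (fun l => (l.drop 3).all (fun a => a == 0)),
      ldot u w = 0 → (w.headD 0 == 0) = true := by
  decide +kernel

theorem L_length : [1, 2, 3, 4, 5, 6, 7, 8].map (fun m => (L m).length) =
    [1, 2, 6, 10, 16, 27, 56, 240] := by
  decide +kernel

theorem reach_ok : ∀ m : Fin 8,
    chkReach (m + 1) (List.ofFn (E m.succ)) = true := by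
  decide +kernel

theorem exists_ofFn {l : List ℤ} (h : l.length = 9) : ∃ v : Fin 9 → ℤ, List.ofFn v = l := by
  refine ⟨fun i => l.get (i.cast h.symm), ?_⟩
  apply List.ext_getElem
  · simp [h]
  · intro i h1 h2
    rw [List.getElem_ofFn]
    rfl

theorem Kl_eq : Kl = List.ofFn K := by decide

theorem exc_of_mem_L {m : ℕ} {v : Fin 9 → ℤ} (h : List.ofFn v ∈ L m) : Exc m v := by
  rw [L, List.mem_filter, Bool.and_eq_true, dropZ] at h
  obtain ⟨h1, h2, -⟩ := h
  obtain ⟨-, h3, h4⟩ := allExc_ok _ h1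
  rw [Kl_eq, ldot_ofFn] at h4
  rw [ldot_ofFn] at h3
  exact ⟨h3, h4, h2⟩

/-- The list consists of orbit members. -/
def Good (m : ℕ) (x : Fin 9 → ℤ) (S : List (List ℤ)) : Prop :=
  ∀ v : Fin 9 → ℤ, List.ofFn v ∈ S → Exc m v ∧ v ∈ MulAction.orbit (G m) x

theorem adj_good {m : ℕ} {x : Fin 9 → ℤ} {S : List (List ℤ)} (hS : Good m x S)
    (hl : ∀ l ∈ S, l.length = 9)
    {v : Fin 9 → ℤ} (hv : List.ofFn v ∈ L m)
    (h : S.any (fun u => adj u (List.ofFn v)) = true) : v ∈ MulAction.orbit (G m) x := by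
  rw [List.any_eq_true] at h
  obtain ⟨u, hu, ha⟩ := h
  obtain ⟨u, rfl⟩ := exists_ofFn (hl u hu)
  obtain ⟨h1, h2⟩ := hS u hu
  rw [adj, Bool.or_eq_true, beq_iff_eq, beq_iff_eq, ldot_ofFn] at ha
  rcases ha with ha | ha
  · exact refl_orbit h1 (exc_of_mem_L hv) ha h2
  · rw [← List.ofFn_injective ha]
    exact h2

theorem L_len {m : ℕ} : ∀ l ∈ L m, l.length = 9 := fun l hl =>
  (allExc_ok l (List.mem_of_mem_filter hl)).1

theorem step_len {m : ℕ} {S : List (List ℤ)} : ∀ l ∈ step m S, l.length = 9 := fun l hl =>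
  L_len l (List.mem_of_mem_filter hl)

theorem step_good {m : ℕ} {x : Fin 9 → ℤ} {S : List (List ℤ)} (hS : Good m x S)
    (hl : ∀ l ∈ S, l.length = 9) : Good m x (step m S) := by
  intro v hv
  rw [step, List.mem_filter] at hv
  exact ⟨exc_of_mem_L hv.1, adj_good hS hl hv.1 hv.2⟩

theorem orbit_mem (m : ℕ) (hm : m + 1 < 9) (v : Fin 9 → ℤ) :
    v ∈ MulAction.orbit (G (m + 1)) (E ⟨m + 1, hm⟩) ↔ List.ofFn v ∈ L (m + 1) := by
  constructor
  · intro h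
    have hv := orbit_exc (E_exc m hm) h
    rw [L, List.mem_filter, Bool.and_eq_true]
    refine ⟨exc_mem hv, dropZ.mpr hv.2.2, ?_⟩
    by_cases h2 : m = 1
    · subst h2
      have hE1 : Exc 2 (E 1) := by
        obtain ⟨a, b, c⟩ := E_exc 0 (by norm_num)
        exact ⟨a, b, fun i hi => c i (by omega)⟩
      obtain ⟨g, rfl⟩ := h
      have hx : Exc 2 (g • E 1) := orbit_exc hE1 ⟨g, rfl⟩
      have hd : dot (g • E 1) (g • E 2) = 0 := by
        refine (g.2.1.1 (E 1) (E 2)).trans ?_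
        decide
      have := L2_ok (List.ofFn (g • E 1))
        (List.mem_filter.mpr ⟨exc_mem hx, dropZ.mpr hx.2.2⟩)
        (List.ofFn (g • E 2))
        (List.mem_filter.mpr ⟨exc_mem hv, dropZ.mpr hv.2.2⟩)
        (by rw [ldot_ofFn]; exact hd)
      rw [Bool.or_eq_true]
      exact Or.inr this
    · have : (m + 1 != 2) = true := by simpa using h2
      rw [this, Bool.true_or]
  · intro h
    have hr := reach_ok ⟨m, by omega⟩
    have h0 : Good (m + 1) (E ⟨m + 1, hm⟩) [List.ofFn (E ⟨m + 1, hm⟩)] := by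
      intro u hu
      rw [List.mem_singleton] at hu
      rw [List.ofFn_injective hu]
      exact ⟨E_exc m hm, MulAction.mem_orbit_self _⟩
    have hl0 : ∀ l ∈ [List.ofFn (E ⟨m + 1, hm⟩)], l.length = 9 := by
      intro l hl
      rw [List.mem_singleton] at hl
      rw [hl, List.length_ofFn]
    rw [chkReach, List.all_eq_true] at hr
    exact adj_good (step_good (step_good h0 hl0) step_len) step_len h (hr _ h)

theorem orbit_card (m : ℕ) (hm : m + 1 < 9) :
    (MulAction.orbit (G (m + 1)) (E ⟨m + 1, hm⟩)).ncard = (L (m + 1)).length := by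
  rw [← Set.ncard_image_of_injective _ (List.ofFn_injective (α := ℤ) (n := 9))]
  have : List.ofFn '' (MulAction.orbit (G (m + 1)) (E ⟨m + 1, hm⟩)) =
      ((L (m + 1)).toFinset : Set (List ℤ)) := by
    ext l
    simp only [Set.mem_image, List.coe_toFinset, Set.mem_ofPred_eq]
    constructor
    · rintro ⟨v, hv, rfl⟩
      exact (orbit_mem m hm v).mp hv
    · intro hl
      obtain ⟨v, rfl⟩ := exists_ofFn (L_len l hl)
      exact ⟨v, (orbit_mem m hm v).mpr hl, rfl⟩
  have hn : (L (m + 1)).Nodup := allExc_nodup.filter _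
  rw [this, Set.ncard_coe_finset, List.toFinset_card_of_nodup hn]

theorem card_AutK : Nat.card AutK = 696729600 := by
  have hL := L_length
  simp only [List.map_cons, List.map_nil, List.cons.injEq, and_true] at hL
  obtain ⟨h1, h2, h3, h4, h5, h6, h7, h8⟩ := hL
  have key : ∀ (m : ℕ) (_ : m + 1 < 9),
      Nat.card (G (m + 1)) = (L (m + 1)).length * Nat.card (G m) := fun m hm => by
    rw [card_step m hm, orbit_card m hm]
  have c0 : Nat.card (G 0) = 1 := by rw [G_zero]; simp
  have c1 := key 0 (by norm_num)
  have c2 := key 1 (by norm_num)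
  have c3 := key 2 (by norm_num)
  have c4 := key 3 (by norm_num)
  have c5 := key 4 (by norm_num)
  have c6 := key 5 (by norm_num)
  have c7 := key 6 (by norm_num)
  have c8 := key 7 (by norm_num)
  norm_num only [h1, h2, h3, h4, h5, h6, h7, h8] at c1 c2 c3 c4 c5 c6 c7 c8
  rw [← G_eight, c8, c7, c6, c5, c4, c3, c2, c1, c0]

/-- The group of all ℤ-linear automorphisms of the dP₈ lattice `ℤ⁹` preserving the
intersection form and fixing `K` is a finite group of order `696729600` (the order of
the Weyl group of E₈). -/
theorem statement13 : Finite ↥AutK ∧ Nat.card ↥AutK = 696729600 := by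
  exact ⟨Nat.finite_of_card_ne_zero (by rw [card_AutK]; norm_num), card_AutK⟩

end Stmt13
end
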